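/- Let [u] = q^{u²/r − u} Θ_{q^{2r}}(q^{2u}) with 0<q<1, r>0, and define b̄(u)=[u]/[u+1], c(u,s)=[1][s+u]/([s][u+1]), c̄(u,s)=[1][s−u]/([s][u+1]). Then for all complex s, v₁, v₂ (at generic values where all expressions are defined): c̄(−v₂,s)/(b̄(−v₂)·b̄(−v₁)) = c̄(−v₂,s−1)/(b̄(−v₂)·b̄(v₂−v₁)) − c̄(−v₁,s−1)·c(v₂−v₁,s)/(b̄(−v₁)·b̄(v₂−v₁)). -/

import Mathlib

noncomputable def pinf (x p : ℂ) : ℂ := ∏' n : ℕ, (1 - x * p ^ n)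

noncomputable def Theta (p z : ℂ) : ℂ := pinf z p * pinf (p / z) p * pinf p p

noncomputable def br (q r : ℝ) (u : ℂ) : ℂ :=
  (q : ℂ) ^ (u ^ 2 / (r : ℂ) - u) * Theta ((q : ℂ) ^ ((2 * r : ℝ) : ℂ)) ((q : ℂ) ^ (2 * u))

noncomputable def bbar (q r : ℝ) (u : ℂ) : ℂ := br q r u / br q r (u + 1)

noncomputable def cc (q r : ℝ) (u s : ℂ) : ℂ :=
  br q r 1 * br q r (s + u) / (br q r s * br q r (u + 1))

noncomputable def cbar (q r : ℝ) (u s : ℂ) : ℂ :=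
  br q r 1 * br q r (s - u) / (br q r s * br q r (u + 1))

open Finset Filter Topology

noncomputable def qPoch (p : ℝ) (n : ℕ) : ℝ := ∏ i ∈ range n, (1 - p ^ (i + 1))

noncomputable def invPoch (p : ℝ) (m : ℤ) : ℝ := if m < 0 then 0 else (qPoch p m.toNat)⁻¹

noncomputable def tripleCoeff (p : ℝ) (N : ℕ) (k : ℤ) : ℝ :=
  qPoch p (2 * N) * qPoch p N * (invPoch p (N + k) * invPoch p (N - k))

section
variable {p : ℝ} (hp0 : 0 < p) (hp1 : p < 1)
include hp0 hp1

theorem qPoch_pos (n : ℕ) : 0 < qPoch p n :=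
  prod_pos fun _ _ => sub_pos.2 (pow_lt_one₀ hp0.le hp1 (Nat.succ_ne_zero _))

theorem qPoch_antitone : Antitone (qPoch p) := by
  refine antitone_nat_of_succ_le fun n => ?_
  rw [qPoch, prod_range_succ]
  exact mul_le_of_le_one_right (qPoch_pos hp0 hp1 n).le (sub_le_self _ (by positivity))

theorem invPoch_sub_one (m : ℤ) : invPoch p (m - 1) = (1 - p ^ m) * invPoch p m := by
  rcases lt_trichotomy m 0 with h | rfl | h
  · simp [invPoch, h, show m - 1 < 0 by omega]
  · simp [invPoch]
  · obtain ⟨n, rfl⟩ : ∃ n : ℕ, m = n + 1 := ⟨(m - 1).toNat, by omega⟩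
    have h1 : ((n : ℤ) + 1).toNat = n + 1 := by omega
    have h2 := (qPoch_pos hp0 hp1 n).ne'
    have h3 : 1 - p ^ (n + 1) ≠ 0 := (sub_pos.2 (pow_lt_one₀ hp0.le hp1 (Nat.succ_ne_zero _))).ne'
    have h4 : p ^ ((n : ℤ) + 1) = p ^ (n + 1) := by exact_mod_cast zpow_natCast p (n + 1)
    have h5 : qPoch p (n + 1) = qPoch p n * (1 - p ^ (n + 1)) := prod_range_succ _ _
    simp only [invPoch, h4, h1, h5, add_sub_cancel_right, Int.toNat_natCast,
      if_neg (show ¬ (n : ℤ) < 0 by omega), if_neg (show ¬ (n : ℤ) + 1 < 0 by omega)]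
    field_simp

theorem tripleCoeff_succ (N : ℕ) (k : ℤ) :
    tripleCoeff p (N + 1) k = (1 - p ^ (N + 1)) * ((1 + p ^ (2 * N + 1)) * tripleCoeff p N k
      + p ^ ((N : ℤ) - (k - 1)) * tripleCoeff p N (k - 1)
      + p ^ ((N : ℤ) + 1 + k) * tripleCoeff p N (k + 1)) := by
  have hp := hp0.ne'
  have e1 : invPoch p (N + k) = (1 - p ^ ((N : ℤ) + 1 + k)) * invPoch p (N + 1 + k) := by
    rw [← invPoch_sub_one hp0 hp1]; congr 1; ring
  have e2 : invPoch p (N - k) = (1 - p ^ ((N : ℤ) + 1 - k)) * invPoch p (N + 1 - k) := by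
    rw [← invPoch_sub_one hp0 hp1]; congr 1; ring
  have e3 : invPoch p (N + (k - 1)) = (1 - p ^ ((N : ℤ) + k)) * invPoch p (N + k) := by
    rw [← invPoch_sub_one hp0 hp1]; congr 1; ring
  have e4 : invPoch p (N - (k + 1)) = (1 - p ^ ((N : ℤ) - k)) * invPoch p (N - k) := by
    rw [← invPoch_sub_one hp0 hp1]; congr 1; ring
  have q1 : qPoch p (N + 1) = qPoch p N * (1 - p ^ (N + 1)) := prod_range_succ _ _
  have q2 : qPoch p (2 * (N + 1)) =
      qPoch p (2 * N) * (1 - p ^ (2 * N + 1)) * (1 - p ^ (2 * N + 2)) := by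
    rw [show 2 * (N + 1) = 2 * N + 1 + 1 by ring, qPoch, prod_range_succ, prod_range_succ]; rfl
  have i1 : (N : ℤ) - (k - 1) = N + 1 - k := by ring
  have i2 : (N : ℤ) + (k + 1) = N + 1 + k := by ring
  simp only [tripleCoeff, e3, e4, e1, e2, q1, q2, i1, i2, Nat.cast_add, Nat.cast_one]
  have x1 : p ^ ((N : ℤ) + k) = p ^ ((N : ℤ) + 1 + k) / p := by
    rw [div_eq_mul_inv, ← zpow_sub_one₀ hp]; congr 1; ring
  have x2 : p ^ ((N : ℤ) - k) = p ^ ((N : ℤ) + 1 - k) / p := by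
    rw [div_eq_mul_inv, ← zpow_sub_one₀ hp]; congr 1; ring
  have x3 : p ^ (2 * N + 2) = p ^ ((N : ℤ) + 1 + k) * p ^ ((N : ℤ) + 1 - k) := by
    rw [← zpow_add₀ hp, ← zpow_natCast]; congr 1; push_cast; ring
  have x4 : p ^ (2 * N + 1) = p ^ ((N : ℤ) + 1 + k) * p ^ ((N : ℤ) + 1 - k) / p := by
    rw [← x3, pow_succ p (2 * N + 1)]; field_simp
  rw [x1, x2, x3, x4]
  field_simp
  ring

theorem tripleCoeff_nonneg (N : ℕ) (k : ℤ) : 0 ≤ tripleCoeff p N k := by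
  have h : ∀ n, 0 < qPoch p n := qPoch_pos hp0 hp1
  have h' : ∀ m, 0 ≤ invPoch p m := fun m => by
    unfold invPoch; split_ifs; exacts [le_rfl, (inv_pos.2 (h _)).le]
  exact mul_nonneg (mul_nonneg (h _).le (h _).le) (mul_nonneg (h' _) (h' _))

theorem qPoch_mul_le {a b c d : ℕ} (hca : c ≤ a) (hdb : d ≤ b) :
    qPoch p a * qPoch p b * ((qPoch p c)⁻¹ * (qPoch p d)⁻¹) ≤ 1 := by
  have hc := qPoch_pos hp0 hp1 c
  have hd := qPoch_pos hp0 hp1 d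
  rw [← mul_inv, ← div_eq_mul_inv, div_le_one (mul_pos hc hd)]
  exact mul_le_mul (qPoch_antitone hp0 hp1 hca) (qPoch_antitone hp0 hp1 hdb)
    (qPoch_pos hp0 hp1 b).le hc.le

theorem tripleCoeff_le_one (N : ℕ) (k : ℤ) : tripleCoeff p N k ≤ 1 := by
  unfold tripleCoeff invPoch
  split_ifs with h1 h2 h2
  · simp
  · simp
  · simp
  · rcases le_total 0 k with hk | hk
    · exact qPoch_mul_le hp0 hp1 (by omega) (by omega)
    · rw [mul_comm (qPoch p _)⁻¹]
      exact qPoch_mul_le hp0 hp1 (by omega) (by omega)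

end

noncomputable def tripleTerm (t : ℝ) (z : ℂ) (k : ℤ) : ℂ :=
  (-1) ^ k * (t : ℂ) ^ (k * (k - 1)) * z ^ k

noncomputable def evenTerm (t : ℝ) (z : ℂ) (k : ℤ) : ℂ := (t : ℂ) ^ (2 * k ^ 2) * z ^ (2 * k)

noncomputable def oddTerm (t : ℝ) (z : ℂ) (k : ℤ) : ℂ :=
  (t : ℂ) ^ (2 * k ^ 2 + 2 * k) * z ^ (2 * k + 1)

theorem injective_add_sub_add_one :
    Function.Injective fun a : ℤ × ℤ => (a.1 + a.2 + 1, a.1 - a.2 + 1) := fun a b h => by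
  simp only [Prod.mk.injEq] at h
  ext <;> omega

theorem injective_add_add_one_sub :
    Function.Injective fun a : ℤ × ℤ => (a.1 + a.2 + 1, a.1 - a.2) := fun a b h => by
  simp only [Prod.mk.injEq] at h
  ext <;> omega

theorem isCompl_range_add_sub :
    IsCompl (Set.range fun a : ℤ × ℤ => (a.1 + a.2 + 1, a.1 - a.2 + 1))
      (Set.range fun a : ℤ × ℤ => (a.1 + a.2 + 1, a.1 - a.2)) := by
  refine ⟨Set.disjoint_left.2 ?_, codisjoint_iff_le_sup.2 ?_⟩
  · rintro _ ⟨a, rfl⟩ ⟨b, h⟩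
    simp only [Prod.mk.injEq] at h
    omega
  · rintro ⟨m, n⟩ -
    rcases Int.even_or_odd' (m + n) with ⟨k, hk | hk⟩
    · exact Or.inl ⟨(k - 1, m - k), by simp only [Prod.mk.injEq]; omega⟩
    · exact Or.inr ⟨(k, m - k - 1), by simp only [Prod.mk.injEq]; omega⟩

theorem HasSum.int_prod_of_parity {f : ℤ × ℤ → ℂ} {a b : ℂ}
    (he : HasSum (fun i : ℤ × ℤ => f (i.1 + i.2 + 1, i.1 - i.2 + 1)) a)
    (ho : HasSum (fun i : ℤ × ℤ => f (i.1 + i.2 + 1, i.1 - i.2)) b) : HasSum f (a + b) :=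
  HasSum.add_isCompl isCompl_range_add_sub (injective_add_sub_add_one.hasSum_range_iff.2 he)
    (injective_add_add_one_sub.hasSum_range_iff.2 ho)

section
variable {t : ℝ} (ht0 : 0 < t) (ht1 : t < 1)
include ht0

theorem tripleTerm_sub_one {z : ℂ} (hz : z ≠ 0) (k : ℤ) :
    z * tripleTerm t z (k - 1) = -((t : ℂ) ^ 2) ^ (-(k - 1)) * tripleTerm t z k := by
  have ht : (t : ℂ) ≠ 0 := by exact_mod_cast ht0.ne'
  have h1 : ((t : ℂ) ^ 2) ^ (-(k - 1)) * (t : ℂ) ^ (k * (k - 1))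
      = (t : ℂ) ^ ((k - 1) * (k - 1 - 1)) := by
    rw [← zpow_natCast, ← zpow_mul, ← zpow_add₀ ht]; congr 1; push_cast; ring
  rw [tripleTerm, tripleTerm, ← h1, zpow_sub_one₀ (by norm_num : (-1 : ℂ) ≠ 0), zpow_sub_one₀ hz]
  field_simp

theorem tripleTerm_add_one {z : ℂ} (hz : z ≠ 0) (k : ℤ) :
    z⁻¹ * tripleTerm t z (k + 1) = -((t : ℂ) ^ 2) ^ k * tripleTerm t z k := by
  have ht : (t : ℂ) ≠ 0 := by exact_mod_cast ht0.ne'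
  have h1 : ((t : ℂ) ^ 2) ^ k * (t : ℂ) ^ (k * (k - 1))
      = (t : ℂ) ^ ((k + 1) * (k + 1 - 1)) := by
    rw [← zpow_natCast, ← zpow_mul, ← zpow_add₀ ht]; congr 1; push_cast; ring
  rw [tripleTerm, tripleTerm, ← h1, zpow_add_one₀ (by norm_num : (-1 : ℂ) ≠ 0), zpow_add_one₀ hz]
  field_simp

include ht1

/-- A finite form of the Jacobi triple product. -/
theorem hasSum_tripleCoeff_mul {z : ℂ} (hz : z ≠ 0) (N : ℕ) :
    HasSum (fun k : ℤ => (tripleCoeff (t ^ 2) N k : ℂ) * tripleTerm t z k)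
      ((∏ n ∈ range N, (1 - z * ((t : ℂ) ^ 2) ^ n)) *
        (∏ n ∈ range N, (1 - (t : ℂ) ^ 2 / z * ((t : ℂ) ^ 2) ^ n)) *
        ∏ n ∈ range N, (1 - (t : ℂ) ^ 2 * ((t : ℂ) ^ 2) ^ n)) := by
  have hp0 : 0 < t ^ 2 := by positivity
  have hp1 : t ^ 2 < 1 := pow_lt_one₀ ht0.le ht1 two_ne_zero
  induction N with
  | zero =>
    convert hasSum_single (0 : ℤ) ?_ using 1
    · simp [tripleCoeff, tripleTerm, invPoch, qPoch]
    · intro k hk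
      have : tripleCoeff (t ^ 2) 0 k = 0 := by
        rcases lt_or_gt_of_ne hk with h | h <;> simp [tripleCoeff, invPoch, h]
      simp [this]
  | succ N ih =>
    have hs := ((Equiv.subRight (1 : ℤ)).hasSum_iff.2 ih).mul_left (z * ((t : ℂ) ^ 2) ^ N)
    have ha := ((Equiv.addRight (1 : ℤ)).hasSum_iff.2 ih).mul_left (z⁻¹ * ((t : ℂ) ^ 2) ^ (N + 1))
    have h0 := ih.mul_left (1 + ((t : ℂ) ^ 2) ^ (2 * N + 1))
    have h := ((h0.sub hs).sub ha).mul_left (1 - ((t : ℂ) ^ 2) ^ (N + 1))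
    have ht : (t : ℂ) ^ 2 ≠ 0 := by exact_mod_cast hp0.ne'
    convert! h using 1
    · funext k
      rw [tripleCoeff_succ hp0 hp1]
      have e1 := tripleTerm_sub_one ht0 hz k
      have e2 := tripleTerm_add_one ht0 hz k
      have p1 : ((t : ℂ) ^ 2) ^ ((N : ℤ) - (k - 1))
          = ((t : ℂ) ^ 2) ^ N * ((t : ℂ) ^ 2) ^ (-(k - 1)) := by
        rw [sub_eq_add_neg, zpow_add₀ ht, zpow_natCast]
      have p2 : ((t : ℂ) ^ 2) ^ ((N : ℤ) + 1 + k)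
          = ((t : ℂ) ^ 2) ^ (N + 1) * ((t : ℂ) ^ 2) ^ k := by
        rw [zpow_add₀ ht]; congr 1
      simp only [Function.comp, Equiv.subRight_apply, Equiv.coe_addRight]
      push_cast
      rw [p1, p2]
      linear_combination (1 - ((t : ℂ) ^ 2) ^ (N + 1)) * ((t : ℂ) ^ 2) ^ N *
          tripleCoeff (t ^ 2) N (k - 1) * e1 +
        (1 - ((t : ℂ) ^ 2) ^ (N + 1)) * ((t : ℂ) ^ 2) ^ (N + 1) *
          tripleCoeff (t ^ 2) N (k + 1) * e2
    · simp only [prod_range_succ]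
      field_simp
      ring

theorem summable_norm_zpow_sq_mul_zpow {w : ℂ} (hw : w ≠ 0) :
    Summable fun n : ℤ => ‖(t : ℂ) ^ (n ^ 2) * w ^ n‖ := by
  have ht : (t : ℂ) ≠ 0 := by exact_mod_cast ht0.ne'
  have hpi : (Real.pi : ℂ) ≠ 0 := by exact_mod_cast Real.pi_ne_zero
  have h := (summable_jacobiTheta₂_term_iff (Complex.log w / (2 * Real.pi * Complex.I))
    (((-Real.log t / Real.pi : ℝ) : ℂ) * Complex.I)).2 (by
      simpa using div_pos (neg_pos.2 (Real.log_neg ht0 ht1)) Real.pi_pos)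
  refine h.norm.congr fun n => ?_
  congr 1
  rw [jacobiTheta₂_term, Complex.exp_add]
  have e1 : 2 * Real.pi * Complex.I * n * (Complex.log w / (2 * Real.pi * Complex.I))
      = n * Complex.log w := by field_simp [Complex.I_ne_zero]
  have e2 : Real.pi * Complex.I * (n : ℂ) ^ 2 * (((-Real.log t / Real.pi : ℝ) : ℂ) * Complex.I)
      = ((n ^ 2 : ℤ) : ℂ) * Complex.log t := by
    rw [← Complex.ofReal_log ht0.le]
    push_cast
    field_simp
    rw [Complex.I_sq]; ring
  rw [e1, e2, Complex.exp_int_mul, Complex.exp_int_mul, Complex.exp_log hw, Complex.exp_log ht,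
    mul_comm]

theorem summable_norm_tripleTerm {z : ℂ} (hz : z ≠ 0) :
    Summable fun k : ℤ => ‖tripleTerm t z k‖ := by
  have ht : (t : ℂ) ≠ 0 := by exact_mod_cast ht0.ne'
  refine (summable_norm_zpow_sq_mul_zpow ht0 ht1 (w := -1 * (t : ℂ)⁻¹ * z)
    (by simp [ht, hz])).congr fun k => ?_
  congr 1
  rw [tripleTerm, show k * (k - 1) = k ^ 2 + -k by ring, zpow_add₀ ht, mul_zpow, mul_zpow, inv_zpow,
    zpow_neg]
  ring

theorem summable_norm_evenTerm {z : ℂ} (hz : z ≠ 0) :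
    Summable fun k : ℤ => ‖evenTerm t z k‖ := by
  refine (summable_norm_zpow_sq_mul_zpow (t := t ^ 2) (by positivity)
    (pow_lt_one₀ ht0.le ht1 two_ne_zero) (w := z ^ 2) (by simp [hz])).congr fun k => ?_
  congr 1
  rw [evenTerm, zpow_mul, zpow_mul]
  push_cast
  norm_cast

theorem summable_norm_oddTerm {z : ℂ} (hz : z ≠ 0) :
    Summable fun k : ℤ => ‖oddTerm t z k‖ := by
  have ht : (t : ℂ) ≠ 0 := by exact_mod_cast ht0.ne'
  refine ((summable_norm_zpow_sq_mul_zpow (t := t ^ 2) (by positivity)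
    (pow_lt_one₀ ht0.le ht1 two_ne_zero) (w := t ^ 2 * z ^ 2) (by simp [hz, ht])).mul_left
    ‖z‖).congr fun k => ?_
  rw [← norm_mul]
  congr 1
  rw [oddTerm, zpow_add₀ ht, zpow_add_one₀ hz, zpow_mul, zpow_mul, zpow_mul, mul_zpow]
  push_cast
  simp only [← zpow_natCast, ← zpow_mul]
  push_cast
  ring

theorem tendsto_tripleCoeff (k : ℤ) :
    Tendsto (fun N => tripleCoeff (t ^ 2) N k) atTop (𝓝 1) := by
  have hp0 : 0 < t ^ 2 := by positivity
  have hp1 : t ^ 2 < 1 := pow_lt_one₀ ht0.le ht1 two_ne_zero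
  have hsum : Summable fun i : ℕ => ‖-(t ^ 2) ^ (i + 1)‖ := by
    simpa [abs_of_pos ht0] using
      (summable_nat_add_iff 1).2 (summable_geometric_of_lt_one hp0.le hp1)
  set C := ∏' i : ℕ, (1 + -(t ^ 2) ^ (i + 1))
  have hC0 : C ≠ 0 := tprod_one_add_ne_zero_of_summable
    (fun i => by
      rw [← sub_eq_add_neg]
      exact (sub_pos.2 (pow_lt_one₀ hp0.le hp1 (Nat.succ_ne_zero _))).ne') hsum
  have hq : Tendsto (qPoch (t ^ 2)) atTop (𝓝 C) := by
    refine (multipliable_one_add_of_summable hsum).hasProd.tendsto_prod_nat.congr fun n => ?_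
    simp only [qPoch, sub_eq_add_neg]
  have hinv : ∀ m : ℤ, Tendsto (fun N : ℕ => invPoch (t ^ 2) (N + m)) atTop (𝓝 C⁻¹) := by
    intro m
    have h1 : Tendsto (fun N : ℕ => ((N : ℤ) + m).toNat) atTop atTop := by
      refine tendsto_atTop.2 fun b => ?_
      filter_upwards [eventually_ge_atTop (b + m.natAbs)] with N hN
      omega
    refine ((hq.comp h1).inv₀ hC0).congr' ?_
    filter_upwards [eventually_ge_atTop m.natAbs] with N hN
    rw [invPoch, if_neg (by omega)]; rfl
  have h2 : Tendsto (fun N : ℕ => 2 * N) atTop atTop :=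
    tendsto_id.const_mul_atTop' two_pos
  have h := ((hq.comp h2).mul hq).mul ((hinv k).mul (hinv (-k)))
  rw [show C * C * (C⁻¹ * C⁻¹) = 1 by field_simp] at h
  simpa only [tripleCoeff, sub_eq_add_neg] using! h

theorem tendsto_prod_pinf (x : ℂ) :
    Tendsto (fun N => ∏ n ∈ range N, (1 - x * ((t : ℂ) ^ 2) ^ n)) atTop
      (𝓝 (pinf x ((t : ℂ) ^ 2))) := by
  have hs : Summable fun n : ℕ => ‖-(x * ((t : ℂ) ^ 2) ^ n)‖ := by
    simp only [norm_neg, norm_mul, norm_pow, Complex.norm_real, Real.norm_eq_abs, abs_of_pos ht0]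
    exact (summable_geometric_of_lt_one (by positivity)
      (pow_lt_one₀ ht0.le ht1 two_ne_zero)).mul_left _
  have h := (multipliable_one_add_of_summable hs).hasProd.tendsto_prod_nat
  simpa only [pinf, ← sub_eq_add_neg] using h

/-- The Jacobi triple product. -/
theorem Theta_eq_tsum {z : ℂ} (hz : z ≠ 0) :
    Theta ((t : ℂ) ^ 2) z = ∑' k : ℤ, tripleTerm t z k := by
  have hp0 : 0 < t ^ 2 := by positivity
  have hp1 : t ^ 2 < 1 := pow_lt_one₀ ht0.le ht1 two_ne_zero
  have hl := ((tendsto_prod_pinf ht0 ht1 z).mul (tendsto_prod_pinf ht0 ht1 ((t : ℂ) ^ 2 / z))).mul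
    (tendsto_prod_pinf ht0 ht1 ((t : ℂ) ^ 2))
  simp only [← (hasSum_tripleCoeff_mul ht0 ht1 hz _).tsum_eq] at hl
  refine tendsto_nhds_unique hl (tendsto_tsum_of_dominated_convergence
    (summable_norm_tripleTerm ht0 ht1 hz) (fun k => ?_) (Eventually.of_forall fun N k => ?_))
  · have h := (Complex.continuous_ofReal.tendsto _).comp (tendsto_tripleCoeff ht0 ht1 k)
    simpa using h.mul_const (tripleTerm t z k)
  · rw [norm_mul, Complex.norm_real, Real.norm_of_nonneg (tripleCoeff_nonneg hp0 hp1 N k)]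
    exact mul_le_of_le_one_left (norm_nonneg _) (tripleCoeff_le_one hp0 hp1 N k)

omit ht1 in
theorem tripleTerm_mul_tripleTerm {x y : ℂ} (hx : x ≠ 0) (hy : y ≠ 0) (m n : ℤ) :
    tripleTerm t (x * y) m * tripleTerm t (x / y) n =
      (-1) ^ (m + n) * (t : ℂ) ^ (m * (m - 1) + n * (n - 1)) * x ^ (m + n) * y ^ (m - n) := by
  have ht : (t : ℂ) ≠ 0 := by exact_mod_cast ht0.ne'
  rw [tripleTerm, tripleTerm, zpow_add₀ ht, zpow_add₀ hx, zpow_sub₀ hy,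
    zpow_add₀ (by norm_num : (-1 : ℂ) ≠ 0), mul_zpow, div_zpow]
  ring

omit ht1 in
theorem tripleTerm_mul_tripleTerm_of_even {x y : ℂ} (hx : x ≠ 0) (hy : y ≠ 0) (k l : ℤ) :
    tripleTerm t (x * y) (k + l + 1) * tripleTerm t (x / y) (k - l + 1) =
      x * (oddTerm t x k * evenTerm t y l) := by
  have ht : (t : ℂ) ≠ 0 := by exact_mod_cast ht0.ne'
  rw [tripleTerm_mul_tripleTerm ht0 hx hy, oddTerm, evenTerm,
    show k + l + 1 + (k - l + 1) = 2 * (k + 1) by ring,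
    show k + l + 1 - (k - l + 1) = 2 * l by ring,
    show (k + l + 1) * (k + l + 1 - 1) + (k - l + 1) * (k - l + 1 - 1)
      = (2 * k ^ 2 + 2 * k) + 2 * l ^ 2 by ring,
    zpow_add₀ ht, (even_two_mul (k + 1)).neg_one_zpow,
    show 2 * (k + 1) = 2 * k + 1 + 1 by ring, zpow_add_one₀ hx (2 * k + 1)]
  ring

omit ht1 in
theorem tripleTerm_mul_tripleTerm_of_odd {x y : ℂ} (hx : x ≠ 0) (hy : y ≠ 0) (k l : ℤ) :
    tripleTerm t (x * y) (k + l + 1) * tripleTerm t (x / y) (k - l) =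
      -(x * (evenTerm t x k * oddTerm t y l)) := by
  have ht : (t : ℂ) ≠ 0 := by exact_mod_cast ht0.ne'
  rw [tripleTerm_mul_tripleTerm ht0 hx hy, oddTerm, evenTerm,
    show k + l + 1 + (k - l) = 2 * k + 1 by ring,
    show k + l + 1 - (k - l) = 2 * l + 1 by ring,
    show (k + l + 1) * (k + l + 1 - 1) + (k - l) * (k - l - 1)
      = 2 * k ^ 2 + (2 * l ^ 2 + 2 * l) by ring,
    zpow_add₀ ht, (odd_two_mul_add_one k).neg_one_zpow, zpow_add_one₀ hx (2 * k)]
  ring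

theorem Theta_mul_Theta_div {x y : ℂ} (hx : x ≠ 0) (hy : y ≠ 0) :
    Theta ((t : ℂ) ^ 2) (x * y) * Theta ((t : ℂ) ^ 2) (x / y) =
      x * ((∑' k, oddTerm t x k) * (∑' k, evenTerm t y k)
        - (∑' k, evenTerm t x k) * ∑' k, oddTerm t y k) := by
  have hox := summable_norm_oddTerm ht0 ht1 hx
  have hoy := summable_norm_oddTerm ht0 ht1 hy
  have hex := summable_norm_evenTerm ht0 ht1 hx
  have hey := summable_norm_evenTerm ht0 ht1 hy
  have he := (hox.of_norm.hasSum.mul hey.of_norm.hasSum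
    (summable_mul_of_summable_norm hox hey)).mul_left x
  have ho := ((hex.of_norm.hasSum.mul hoy.of_norm.hasSum
    (summable_mul_of_summable_norm hex hoy)).mul_left x).neg
  simp only [← tripleTerm_mul_tripleTerm_of_even ht0 hx hy] at he
  simp only [← tripleTerm_mul_tripleTerm_of_odd ht0 hx hy] at ho
  have h := HasSum.int_prod_of_parity
    (f := fun i => tripleTerm t (x * y) i.1 * tripleTerm t (x / y) i.2) he ho
  rw [Theta_eq_tsum ht0 ht1 (mul_ne_zero hx hy), Theta_eq_tsum ht0 ht1 (div_ne_zero hx hy),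
    tsum_mul_tsum_of_summable_norm (summable_norm_tripleTerm ht0 ht1 (mul_ne_zero hx hy))
      (summable_norm_tripleTerm ht0 ht1 (div_ne_zero hx hy)), h.tsum_eq]
  ring

end

theorem exists_br_add_mul_br_sub {q r : ℝ} (hq0 : 0 < q) (hq1 : q < 1) (hr : 0 < r) :
    ∃ A B : ℂ → ℂ, ∀ a b, br q r (a + b) * br q r (a - b) = A a * B b - B a * A b := by
  have hq : (q : ℂ) ≠ 0 := by exact_mod_cast hq0.ne'
  have hr' : (r : ℂ) ≠ 0 := by exact_mod_cast hr.ne'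
  have ht0 : 0 < q ^ r := Real.rpow_pos_of_pos hq0 r
  have ht1 : q ^ r < 1 := Real.rpow_lt_one hq0.le hq1 hr
  have hp : (q : ℂ) ^ ((2 * r : ℝ) : ℂ) = ((q ^ r : ℝ) : ℂ) ^ 2 := by
    rw [← Complex.ofReal_cpow hq0.le, mul_comm, Real.rpow_mul hq0.le]
    norm_cast
  have hne (u : ℂ) : (q : ℂ) ^ u ≠ 0 := by simp [Complex.cpow_eq_zero_iff, hq]
  refine ⟨fun a => (q : ℂ) ^ (2 * a ^ 2 / r) * ∑' k, oddTerm (q ^ r) ((q : ℂ) ^ (2 * a)) k,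
    fun a => (q : ℂ) ^ (2 * a ^ 2 / r) * ∑' k, evenTerm (q ^ r) ((q : ℂ) ^ (2 * a)) k,
    fun a b => ?_⟩
  have h := Theta_mul_Theta_div ht0 ht1 (hne (2 * a)) (hne (2 * b))
  have e : (q : ℂ) ^ ((a + b) ^ 2 / r - (a + b)) * (q : ℂ) ^ ((a - b) ^ 2 / r - (a - b)) *
      (q : ℂ) ^ (2 * a) = (q : ℂ) ^ (2 * a ^ 2 / r) * (q : ℂ) ^ (2 * b ^ 2 / r) := by
    rw [← Complex.cpow_add _ _ hq, ← Complex.cpow_add _ _ hq, ← Complex.cpow_add _ _ hq]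
    congr 1
    field_simp
    ring
  rw [← Complex.cpow_add _ _ hq, ← Complex.cpow_sub _ _ hq, ← mul_add, ← mul_sub] at h
  simp only [br, hp]
  linear_combination (q : ℂ) ^ ((a + b) ^ 2 / r - (a + b)) *
    (q : ℂ) ^ ((a - b) ^ 2 / r - (a - b)) * h + ((∑' k, oddTerm (q ^ r) ((q : ℂ) ^ (2 * a)) k) *
      (∑' k, evenTerm (q ^ r) ((q : ℂ) ^ (2 * b)) k) -
      (∑' k, evenTerm (q ^ r) ((q : ℂ) ^ (2 * a)) k) *
      ∑' k, oddTerm (q ^ r) ((q : ℂ) ^ (2 * b)) k) * e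

theorem br_three_term {q r : ℝ} (hq0 : 0 < q) (hq1 : q < 1) (hr : 0 < r) (a b c d : ℂ) :
    br q r (a + b) * br q r (a - b) * (br q r (c + d) * br q r (c - d))
      - br q r (a + c) * br q r (a - c) * (br q r (b + d) * br q r (b - d))
      + br q r (a + d) * br q r (a - d) * (br q r (b + c) * br q r (b - c)) = 0 := by
  obtain ⟨A, B, h⟩ := exists_br_add_mul_br_sub hq0 hq1 hr
  simp only [h]
  ring

theorem br_neg {q r : ℝ} (hq0 : 0 < q) (hq1 : q < 1) (hr : 0 < r) {s : ℂ} (hs : br q r s ≠ 0)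
    (u : ℂ) : br q r (-u) = -br q r u := by
  obtain ⟨A, B, h⟩ := exists_br_add_mul_br_sub hq0 hq1 hr
  have h1 := h ((s + u) / 2) ((s - u) / 2)
  have h2 := h ((s - u) / 2) ((s + u) / 2)
  rw [show (s + u) / 2 + (s - u) / 2 = s by ring, show (s + u) / 2 - (s - u) / 2 = u by ring] at h1
  rw [show (s - u) / 2 + (s + u) / 2 = s by ring, show (s - u) / 2 - (s + u) / 2 = -u by ring] at h2
  apply mul_left_cancel₀ hs
  linear_combination h1 + h2

theorem KE_exchange_identity (q r : ℝ) (hq0 : 0 < q) (hq1 : q < 1) (hr : 0 < r)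
    (s v₁ v₂ : ℂ)
    (h1 : br q r s ≠ 0) (h2 : br q r (s - 1) ≠ 0)
    (h3 : br q r (-v₁) ≠ 0) (h4 : br q r (-v₂) ≠ 0)
    (h5 : br q r (v₂ - v₁) ≠ 0)
    (h6 : br q r (-v₁ + 1) ≠ 0) (h7 : br q r (-v₂ + 1) ≠ 0)
    (h8 : br q r (v₂ - v₁ + 1) ≠ 0) :
    cbar q r (-v₂) s / (bbar q r (-v₂) * bbar q r (-v₁))
      = cbar q r (-v₂) (s - 1) / (bbar q r (-v₂) * bbar q r (v₂ - v₁))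
        - cbar q r (-v₁) (s - 1) * cc q r (v₂ - v₁) s
            / (bbar q r (-v₁) * bbar q r (v₂ - v₁)) := by
  have h := br_three_term hq0 hq1 hr (s + (v₂ - 1) / 2) ((v₂ + 1) / 2) ((1 + v₂) / 2 - v₁)
    ((1 - v₂) / 2)
  rw [show s + (v₂ - 1) / 2 + (v₂ + 1) / 2 = s + v₂ by ring,
    show s + (v₂ - 1) / 2 - (v₂ + 1) / 2 = s - 1 by ring,
    show (1 + v₂) / 2 - v₁ + (1 - v₂) / 2 = -v₁ + 1 by ring,
    show (1 + v₂) / 2 - v₁ - (1 - v₂) / 2 = v₂ - v₁ by ring,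
    show s + (v₂ - 1) / 2 + ((1 + v₂) / 2 - v₁) = s + (v₂ - v₁) by ring,
    show s + (v₂ - 1) / 2 - ((1 + v₂) / 2 - v₁) = s - 1 + v₁ by ring,
    show (v₂ + 1) / 2 + (1 - v₂) / 2 = 1 by ring,
    show (v₂ + 1) / 2 - (1 - v₂) / 2 = -(-v₂) by ring,
    show s + (v₂ - 1) / 2 + (1 - v₂) / 2 = s by ring,
    show s + (v₂ - 1) / 2 - (1 - v₂) / 2 = s - 1 + v₂ by ring,
    show (v₂ + 1) / 2 + ((1 + v₂) / 2 - v₁) = v₂ - v₁ + 1 by ring,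
    show (v₂ + 1) / 2 - ((1 + v₂) / 2 - v₁) = -(-v₁) by ring,
    br_neg hq0 hq1 hr h1 (-v₂), br_neg hq0 hq1 hr h1 (-v₁)] at h
  simp only [cbar, bbar, cc, sub_neg_eq_add]
  field_simp
  linear_combination br q r 1 * h
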